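/- arXiv:1003.1649 — 2 statements merged into one kernel-verified Lean document; each statement's English description precedes it below -/
import Mathlib

section
/- Let n ≥ 1 be an integer and let f : ℝⁿ → ℝ be a bounded, continuously differentiable function with bounded gradient. Then the logarithmic Sobolev inequality ∫_{ℝⁿ} f(x)² log(f(x)²) dμ(x) − (∫_{ℝⁿ} f² dμ) · log(∫_{ℝⁿ} f² dμ) ≤ 2 ∫_{ℝⁿ} ‖∇f(x)‖² dμ(x) holds, with the convention 0·log 0 = 0. -/
open MeasureTheory

/-- The standard Gaussian measure on `ℝⁿ`. -/
noncomputable def stdGaussian (n : ℕ) : Measure (EuclideanSpace ℝ (Fin n)) :=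
  volume.withDensity fun x =>
    ENNReal.ofReal ((2 * Real.pi) ^ (-(n : ℝ) / 2) * Real.exp (-‖x‖ ^ 2 / 2))

section

open scoped RealInnerProductSpace

/-- The density of the standard Gaussian measure on `ℝⁿ`. -/
noncomputable def gaussianDensity (n : ℕ) (x : EuclideanSpace ℝ (Fin n)) : ℝ :=
  (2 * Real.pi) ^ (-(n : ℝ) / 2) * Real.exp (-‖x‖ ^ 2 / 2)

variable {n : ℕ}

local notation "E" => EuclideanSpace ℝ (Fin n)

lemma stdGaussian_eq_withDensity :
    stdGaussian n = volume.withDensity fun x => ENNReal.ofReal (gaussianDensity n x) := rfl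

lemma gaussianDensity_nonneg (x : E) : 0 ≤ gaussianDensity n x := by
  unfold gaussianDensity; positivity

lemma continuous_gaussianDensity : Continuous (gaussianDensity n) := by
  unfold gaussianDensity; fun_prop

lemma hasGradientAt_gaussianDensity (x : E) :
    HasGradientAt (gaussianDensity n) (-(gaussianDensity n x • x)) x := by
  rw [hasGradientAt_iff_hasFDerivAt]
  have h := ((((hasStrictFDerivAt_norm_sq x).hasFDerivAt.neg.mul_const (1 / 2 : ℝ)).exp).const_mul
    ((2 * Real.pi) ^ (-(n : ℝ) / 2)))
  refine (h.congr_fderiv ?_).congr_of_eventuallyEq (.of_forall fun y => ?_)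
  · ext y
    simp [gaussianDensity, div_eq_mul_inv]
    ring
  · simp [gaussianDensity, div_eq_mul_inv]

lemma integral_stdGaussian_eq {F : Type*} [NormedAddCommGroup F] [NormedSpace ℝ F] (h : E → F) :
    ∫ x, h x ∂stdGaussian n = ∫ x, gaussianDensity n x • h x := by
  rw [stdGaussian_eq_withDensity, integral_withDensity_eq_integral_toReal_smul
    continuous_gaussianDensity.measurable.ennreal_ofReal
    (.of_forall fun _ => ENNReal.ofReal_lt_top)]
  simp_rw [ENNReal.toReal_ofReal (gaussianDensity_nonneg _)]

lemma integrable_stdGaussian_iff {F : Type*} [NormedAddCommGroup F] [NormedSpace ℝ F] (h : E → F) :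
    Integrable h (stdGaussian n) ↔ Integrable fun x => gaussianDensity n x • h x := by
  rw [stdGaussian_eq_withDensity, integrable_withDensity_iff_integrable_smul'
    continuous_gaussianDensity.measurable.ennreal_ofReal
    (.of_forall fun _ => ENNReal.ofReal_lt_top)]
  simp_rw [ENNReal.toReal_ofReal (gaussianDensity_nonneg _)]

lemma integrable_gaussianDensity : Integrable (gaussianDensity n) := by
  have h := (GaussianFourier.integrable_cexp_neg_mul_sq_norm_add (V := E)
    (b := 1 / 2) (by norm_num) 0 0).norm.const_mul ((2 * Real.pi) ^ (-(n : ℝ) / 2))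
  refine h.congr (.of_forall fun x => ?_)
  simp [gaussianDensity, Complex.norm_exp]
  left
  norm_cast
  simp [div_eq_inv_mul]

lemma stdGaussian_eq : stdGaussian n = ProbabilityTheory.stdGaussian E := by
  have : IsFiniteMeasure (stdGaussian n) := by
    rw [← integrable_const_iff_isFiniteMeasure (c := (1 : ℝ)) one_ne_zero,
      integrable_stdGaussian_iff]
    simpa using integrable_gaussianDensity
  refine Measure.ext_of_charFun ?_
  ext t
  rw [ProbabilityTheory.charFun_stdGaussian, charFun_apply, integral_stdGaussian_eq]
  have h := GaussianFourier.integral_cexp_neg_mul_sq_norm_add (V := E)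
    (b := 1 / 2) (by norm_num) Complex.I t
  have h' : ∀ x : E, gaussianDensity n x • Complex.exp (⟪x, t⟫ * Complex.I)
      = ((2 * Real.pi : ℝ) ^ (-(n : ℝ) / 2) : ℝ) *
        Complex.exp (-(1 / 2) * ‖x‖ ^ 2 + Complex.I * ⟪t, x⟫) := by
    intro x
    rw [Complex.real_smul, gaussianDensity, Complex.exp_add, real_inner_comm]
    push_cast
    rw [mul_assoc]
    congr 3
    · ring
    · ring
  simp_rw [h', integral_const_mul, h]
  rw [← mul_assoc]
  have h2 : ((Real.pi / (1 / 2) : ℂ)) ^ ((Module.finrank ℝ E : ℂ) / 2)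
      = (((2 * Real.pi : ℝ) ^ ((n : ℝ) / 2) : ℝ) : ℂ) := by
    rw [Complex.ofReal_cpow (by positivity)]
    simp
    ring_nf
  rw [h2, ← Complex.ofReal_mul, ← Real.rpow_add (by positivity)]
  simp
  ring_nf
  simp

instance : ProbabilityTheory.IsGaussian (stdGaussian n) := by
  rw [stdGaussian_eq]; infer_instance

instance : IsProbabilityMeasure (stdGaussian n) := by
  rw [stdGaussian_eq]; infer_instance

lemma measurePreserving_rotation_stdGaussian (θ : ℝ) :
    MeasurePreserving (fun z : E × E =>
      (Real.cos θ • z.1 + Real.sin θ • z.2, -Real.sin θ • z.1 + Real.cos θ • z.2))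
      ((stdGaussian n).prod (stdGaussian n)) ((stdGaussian n).prod (stdGaussian n)) := by
  refine ⟨by fun_prop, ?_⟩
  have h := ProbabilityTheory.IsGaussian.map_rotation_eq_self_of_forall_strongDual_eq_zero
    (μ := stdGaussian n) (fun L => by
      rw [stdGaussian_eq]; exact ProbabilityTheory.integral_strongDual_stdGaussian L) θ
  exact h

/-- Gaussian integration by parts. -/
lemma integral_inner_mul_stdGaussian {w : E → ℝ} {w' : E → E}
    (hw : ∀ v, HasGradientAt w (w' v) v) (hw' : Continuous w') {C C' : ℝ}
    (hC : ∀ v, |w v| ≤ C) (hC' : ∀ v, ‖w' v‖ ≤ C') (a : E) :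
    ∫ v, w v * ⟪a, v⟫ ∂stdGaussian n = ∫ v, ⟪w' v, a⟫ ∂stdGaussian n := by
  have hwc : Continuous w := continuous_iff_continuousAt.2 fun v => (hw v).continuousAt
  have hid : Integrable (fun v : E => v) (stdGaussian n) :=
    ProbabilityTheory.IsGaussian.integrable_id
  have h1 : Integrable w (stdGaussian n) := .of_bound hwc.aestronglyMeasurable C (.of_forall hC)
  have h2 : Integrable (fun v => w v * ⟪a, v⟫) (stdGaussian n) :=
    (hid.const_inner a).bdd_mul hwc.aestronglyMeasurable (.of_forall hC)
  have h3 : Integrable (fun v => ⟪w' v, a⟫) (stdGaussian n) :=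
    (Integrable.of_bound hw'.aestronglyMeasurable C' (.of_forall hC')).inner_const a
  have e1 : ∀ v, fderiv ℝ (gaussianDensity n) v a = - (gaussianDensity n v * ⟪a, v⟫) := fun v => by
    rw [(hasGradientAt_gaussianDensity v).fderiv_apply, inner_neg_left, real_inner_smul_left,
      real_inner_comm]
  have e2 : ∀ v, fderiv ℝ w v a = ⟪w' v, a⟫ := fun v => (hw v).fderiv_apply
  rw [integrable_stdGaussian_iff] at h1 h2 h3
  have h := integral_mul_fderiv_eq_neg_fderiv_mul_of_integrable (𝕜 := ℝ) (μ := volume)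
    (f := w) (g := gaussianDensity n) (v := a) ?_ ?_ ?_ (fun v _ => (hw v).differentiableAt)
    (fun v _ => (hasGradientAt_gaussianDensity v).differentiableAt)
  · simp_rw [e1, e2] at h
    rw [integral_stdGaussian_eq, integral_stdGaussian_eq]
    simp only [mul_neg, integral_neg, neg_inj] at h
    simp only [smul_eq_mul]
    refine Eq.trans ?_ (h.trans ?_) <;> congr with v <;> ring
  · refine h3.congr (.of_forall fun v => ?_)
    simp [e2, mul_comm]
  · refine h2.neg.congr (.of_forall fun v => ?_)
    simp [e1]; ring
  · refine h1.congr (.of_forall fun v => ?_)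
    simp [mul_comm]

lemma integral_comp_rotation_stdGaussian (θ : ℝ) {h : E × E → ℝ} (hh : Continuous h) :
    ∫ z, h (Real.cos θ • z.1 + Real.sin θ • z.2, -Real.sin θ • z.1 + Real.cos θ • z.2)
      ∂(stdGaussian n).prod (stdGaussian n) = ∫ z, h z ∂(stdGaussian n).prod (stdGaussian n) := by
  have h1 := measurePreserving_rotation_stdGaussian (n := n) θ
  conv_rhs => rw [← h1.map_eq]
  rw [integral_map h1.aemeasurable hh.aestronglyMeasurable]

/-- The Ornstein–Uhlenbeck semigroup, with the time `t` parametrized by `cos θ = exp (-t)`. -/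
noncomputable def mehler {F : Type*} [NormedAddCommGroup F] [NormedSpace ℝ F]
    (h : E → F) (θ : ℝ) (x : E) : F :=
  ∫ y, h (Real.cos θ • x + Real.sin θ • y) ∂stdGaussian n

lemma integrable_mehler_integrand {F : Type*} [NormedAddCommGroup F]
    {h : E → F} {C : ℝ} (hh : Continuous h) (hC : ∀ x, ‖h x‖ ≤ C)
    (θ : ℝ) (x : E) :
    Integrable (fun y => h (Real.cos θ • x + Real.sin θ • y)) (stdGaussian n) :=
  .of_bound (Continuous.aestronglyMeasurable (by fun_prop)) C (.of_forall fun _ => hC _)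

section mehler

variable {F : Type*} [NormedAddCommGroup F] [NormedSpace ℝ F]
  {h : EuclideanSpace ℝ (Fin n) → F} {C : ℝ}

lemma norm_mehler_le (hC : ∀ x, ‖h x‖ ≤ C) (θ : ℝ) (x : E) : ‖mehler h θ x‖ ≤ C := by
  simpa [mehler] using norm_integral_le_of_norm_le_const (μ := stdGaussian n)
    (.of_forall fun y => hC (Real.cos θ • x + Real.sin θ • y))

lemma continuous_mehler (hh : Continuous h) (hC : ∀ x, ‖h x‖ ≤ C) (θ : ℝ) :
    Continuous (mehler h θ) :=
  continuous_of_dominated (fun _ => Continuous.aestronglyMeasurable (by fun_prop))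
    (fun _ => .of_forall fun _ => hC _) (integrable_const C) (.of_forall fun _ => by fun_prop)

end mehler

variable {g : EuclideanSpace ℝ (Fin n) → ℝ}
  {G : EuclideanSpace ℝ (Fin n) → EuclideanSpace ℝ (Fin n)} {ε C L : ℝ}

lemma le_mehler (hg : Continuous g) (hC : ∀ x, |g x| ≤ C) (hε : ∀ x, ε ≤ g x) (θ : ℝ) (x : E) :
    ε ≤ mehler g θ x := by
  simpa [mehler] using integral_mono (integrable_const ε) (integrable_mehler_integrand hg hC θ x)
    fun y => hε _

lemma hasGradientAt_mehler (hg : ∀ x, HasGradientAt g (G x) x) (hG : Continuous G)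
    (hC : ∀ x, |g x| ≤ C) (hL : ∀ x, ‖G x‖ ≤ L) (θ : ℝ) (x : E) :
    HasGradientAt (mehler g θ) (Real.cos θ • mehler G θ x) x := by
  have hgc : Continuous g := continuous_iff_continuousAt.2 fun v => (hg v).continuousAt
  rw [hasGradientAt_iff_hasFDerivAt]
  have h := hasFDerivAt_integral_of_dominated_of_fderiv_le (𝕜 := ℝ) (μ := stdGaussian n)
    (F := fun x y => g (Real.cos θ • x + Real.sin θ • y))
    (F' := fun x y => Real.cos θ •
      InnerProductSpace.toDual ℝ E (G (Real.cos θ • x + Real.sin θ • y)))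
    (x₀ := x) (bound := fun _ => L) Filter.univ_mem
    (.of_forall fun _ => Continuous.aestronglyMeasurable (by fun_prop))
    (integrable_mehler_integrand hgc hC θ x)
    (Continuous.aestronglyMeasurable (by fun_prop)) (.of_forall fun y z _ => ?_) (integrable_const L)
    (.of_forall fun y z _ => ?_)
  · refine h.congr_fderiv ?_
    have := (InnerProductSpace.toDual ℝ E).toContinuousLinearEquiv.toContinuousLinearMap
      |>.integral_comp_comm (integrable_mehler_integrand hG hL θ x)
    rw [integral_smul, map_smul]
    congr 1
  · rw [norm_smul, LinearIsometryEquiv.norm_map]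
    exact (mul_le_of_le_one_left (norm_nonneg _) (Real.abs_cos_le_one θ)).trans (hL _)
  · have h1 : HasFDerivAt (fun z : E => Real.cos θ • z + Real.sin θ • y)
        (Real.cos θ • ContinuousLinearMap.id ℝ E) z :=
      ((hasFDerivAt_id z).const_smul (Real.cos θ)).add_const _
    refine ((hg _).hasFDerivAt.comp z h1).congr_fderiv ?_
    ext v
    simp

lemma norm_neg_sin_smul_add_cos_smul_le (θ : ℝ) (x y : E) :
    ‖-Real.sin θ • x + Real.cos θ • y‖ ≤ ‖x‖ + ‖y‖ := by
  refine (norm_add_le _ _).trans (add_le_add ?_ ?_) <;> rw [norm_smul] <;>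
    refine mul_le_of_le_one_left (norm_nonneg _) ?_
  · simpa using Real.abs_sin_le_one θ
  · exact Real.abs_cos_le_one θ

lemma abs_inner_rotation_le (hL : ∀ x, ‖G x‖ ≤ L) (θ : ℝ) (x y : E) :
    |⟪G (Real.cos θ • x + Real.sin θ • y), -Real.sin θ • x + Real.cos θ • y⟫| ≤
      L * (‖x‖ + ‖y‖) :=
  (abs_real_inner_le_norm _ _).trans <| mul_le_mul (hL _)
    (norm_neg_sin_smul_add_cos_smul_le θ x y) (norm_nonneg _) ((norm_nonneg _).trans (hL 0))

lemma integrable_norm_stdGaussian : Integrable (fun x : E => ‖x‖) (stdGaussian n) :=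
  (ProbabilityTheory.IsGaussian.integrable_id (μ := stdGaussian n)).norm

lemma hasDerivAt_mehler (hg : ∀ x, HasGradientAt g (G x) x) (hG : Continuous G)
    (hC : ∀ x, |g x| ≤ C) (hL : ∀ x, ‖G x‖ ≤ L) (θ : ℝ) (x : E) :
    HasDerivAt (fun θ => mehler g θ x)
      (∫ y, ⟪G (Real.cos θ • x + Real.sin θ • y), -Real.sin θ • x + Real.cos θ • y⟫
        ∂stdGaussian n) θ := by
  have hgc : Continuous g := continuous_iff_continuousAt.2 fun v => (hg v).continuousAt
  refine (hasDerivAt_integral_of_dominated_loc_of_deriv_le (𝕜 := ℝ) (μ := stdGaussian n)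
    (F := fun θ y => g (Real.cos θ • x + Real.sin θ • y))
    (F' := fun θ y =>
      ⟪G (Real.cos θ • x + Real.sin θ • y), -Real.sin θ • x + Real.cos θ • y⟫)
    (bound := fun y => L * (‖x‖ + ‖y‖)) Filter.univ_mem
    (.of_forall fun _ => Continuous.aestronglyMeasurable (by fun_prop))
    (integrable_mehler_integrand hgc hC θ x)
    (Continuous.aestronglyMeasurable (by fun_prop))
    (.of_forall fun y t _ => abs_inner_rotation_le hL t x y)
    (((integrable_const _).add integrable_norm_stdGaussian).const_mul L)
    (.of_forall fun y t _ => ?_)).2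
  have h1 : HasDerivAt (fun t : ℝ => Real.cos t • x + Real.sin t • y)
      (-Real.sin t • x + Real.cos t • y) t :=
    ((Real.hasDerivAt_cos t).smul_const x).add ((Real.hasDerivAt_sin t).smul_const y)
  simpa [Function.comp_def] using (hg _).hasFDerivAt.comp_hasDerivAt t h1

/-- The derivative of the Ornstein–Uhlenbeck semigroup, integrated by parts against `w`. -/
lemma integral_mul_integral_inner_rotation {w : E → ℝ} {w' : E → E} {M M' : ℝ}
    (hw : ∀ v, HasGradientAt w (w' v) v) (hw' : Continuous w')
    (hM : ∀ v, |w v| ≤ M) (hM' : ∀ v, ‖w' v‖ ≤ M')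
    (hG : Continuous G) (hL : ∀ x, ‖G x‖ ≤ L) (θ : ℝ) :
    ∫ x, w x * ∫ y, ⟪G (Real.cos θ • x + Real.sin θ • y), -Real.sin θ • x + Real.cos θ • y⟫
        ∂stdGaussian n ∂stdGaussian n =
      -Real.sin θ * ∫ z, ⟪w' z.1, G (Real.cos θ • z.1 + Real.sin θ • z.2)⟫
        ∂(stdGaussian n).prod (stdGaussian n) := by
  have hwc : Continuous w := continuous_iff_continuousAt.2 fun v => (hw v).continuousAt
  have hinv : ∀ z : E × E, Real.cos θ • (Real.cos θ • z.1 + Real.sin θ • z.2) +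
      -Real.sin θ • (-Real.sin θ • z.1 + Real.cos θ • z.2) = z.1 := fun z => by
    have : z.1 = (Real.cos θ ^ 2 + Real.sin θ ^ 2) • z.1 := by
      rw [Real.cos_sq_add_sin_sq, one_smul]
    conv_rhs => rw [this]
    module
  have hM0 : 0 ≤ M := (abs_nonneg _).trans (hM 0)
  have i1 : Integrable (fun z : E × E => w z.1 * ⟪G (Real.cos θ • z.1 + Real.sin θ • z.2),
      -Real.sin θ • z.1 + Real.cos θ • z.2⟫) ((stdGaussian n).prod (stdGaussian n)) := by
    refine Integrable.mono' (((integrable_norm_stdGaussian.comp_fst _).add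
      (integrable_norm_stdGaussian.comp_snd _)).const_mul (M * L))
      (Continuous.aestronglyMeasurable (by fun_prop)) (.of_forall fun z => ?_)
    rw [norm_mul, mul_assoc]
    exact mul_le_mul (hM _) (abs_inner_rotation_le hL θ z.1 z.2) (abs_nonneg _) hM0
  have i2 : Integrable (fun z : E × E => w (Real.cos θ • z.1 + -Real.sin θ • z.2) * ⟪G z.1, z.2⟫)
      ((stdGaussian n).prod (stdGaussian n)) := by
    refine Integrable.mono' ((integrable_norm_stdGaussian.comp_snd _).const_mul (M * L))
      (Continuous.aestronglyMeasurable (by fun_prop)) (.of_forall fun z => ?_)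
    rw [norm_mul, mul_assoc]
    exact mul_le_mul (hM _) ((abs_real_inner_le_norm _ _).trans
      (mul_le_mul_of_nonneg_right (hL _) (norm_nonneg _))) (abs_nonneg _) hM0
  have i3 : Integrable (fun z : E × E => ⟪w' (Real.cos θ • z.1 + -Real.sin θ • z.2), G z.1⟫)
      ((stdGaussian n).prod (stdGaussian n)) := by
    refine .of_bound (Continuous.aestronglyMeasurable (by fun_prop)) (M' * L)
      (.of_forall fun z => ?_)
    exact (abs_real_inner_le_norm _ _).trans
      (mul_le_mul (hM' _) (hL _) (norm_nonneg _) ((norm_nonneg _).trans (hM' 0)))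
  simp_rw [← integral_const_mul (w _)]
  rw [← integral_prod _ i1]
  have r1 := integral_comp_rotation_stdGaussian (n := n) θ
    (h := fun z => w (Real.cos θ • z.1 + -Real.sin θ • z.2) * ⟪G z.1, z.2⟫) (by fun_prop)
  have r2 := integral_comp_rotation_stdGaussian (n := n) θ
    (h := fun z => ⟪w' (Real.cos θ • z.1 + -Real.sin θ • z.2), G z.1⟫) (by fun_prop)
  simp only [hinv] at r1 r2
  rw [r1, r2, integral_prod _ i2, integral_prod _ i3, ← integral_const_mul]
  refine integral_congr_ae (.of_forall fun u => ?_)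
  have hws : ∀ v, HasGradientAt (fun v => w (Real.cos θ • u + -Real.sin θ • v))
      (-Real.sin θ • w' (Real.cos θ • u + -Real.sin θ • v)) v := fun v => by
    have h1 : HasFDerivAt (fun v : E => Real.cos θ • u + -Real.sin θ • v)
        (-Real.sin θ • ContinuousLinearMap.id ℝ E) v :=
      ((hasFDerivAt_id v).const_smul (-Real.sin θ)).const_add _
    rw [hasGradientAt_iff_hasFDerivAt]
    refine ((hw _).hasFDerivAt.comp v h1).congr_fderiv ?_
    ext a
    simp
  have := integral_inner_mul_stdGaussian hws (by fun_prop) (fun v => hM _) (C' := M')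
    (fun v => ?_) (G u)
  · simp only [real_inner_smul_left, integral_const_mul] at this
    exact this
  · rw [norm_smul, norm_neg]
    exact (mul_le_of_le_one_left (norm_nonneg _) (Real.abs_sin_le_one θ)).trans (hM' _)

lemma abs_log_le_of_mem_Icc {p : ℝ} (hε : 0 < ε) (hp : ε ≤ p) (hpC : p ≤ C) :
    |Real.log p| ≤ |Real.log ε| + |Real.log C| := by
  have h1 := Real.log_le_log hε hp
  have h2 := Real.log_le_log (hε.trans_le hp) hpC
  rw [abs_le]
  constructor <;> linarith [neg_abs_le (Real.log ε), le_abs_self (Real.log C),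
    abs_nonneg (Real.log ε), abs_nonneg (Real.log C)]

lemma hasDerivAt_integral_mehler_mul_log (hg : ∀ x, HasGradientAt g (G x) x) (hG : Continuous G)
    (hε0 : 0 < ε) (hε : ∀ x, ε ≤ g x) (hC : ∀ x, |g x| ≤ C) (hL : ∀ x, ‖G x‖ ≤ L) (θ : ℝ) :
    HasDerivAt (fun θ => ∫ x, mehler g θ x * Real.log (mehler g θ x) ∂stdGaussian n)
      (∫ x, (Real.log (mehler g θ x) + 1) *
        ∫ y, ⟪G (Real.cos θ • x + Real.sin θ • y), -Real.sin θ • x + Real.cos θ • y⟫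
        ∂stdGaussian n ∂stdGaussian n) θ := by
  have hgc : Continuous g := continuous_iff_continuousAt.2 fun v => (hg v).continuousAt
  have hP : ∀ θ x, ε ≤ mehler g θ x := le_mehler hgc hC hε
  have hPC : ∀ θ x, |mehler g θ x| ≤ C := norm_mehler_le (h := g) hC
  have hPc : ∀ θ, Continuous (mehler g θ) := continuous_mehler hgc hC
  have hlog : ∀ θ x, |Real.log (mehler g θ x)| ≤ |Real.log ε| + |Real.log C| := fun θ x =>
    abs_log_le_of_mem_Icc hε0 (hP θ x) ((le_abs_self _).trans (hPC θ x))
  have hlogc : ∀ θ, Continuous fun x => Real.log (mehler g θ x) := fun θ =>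
    (hPc θ).log fun x => (hε0.trans_le (hP θ x)).ne'
  have hC0 : 0 ≤ C := (abs_nonneg _).trans (hC 0)
  refine (hasDerivAt_integral_of_dominated_loc_of_deriv_le (𝕜 := ℝ) (μ := stdGaussian n)
    (F := fun θ x => mehler g θ x * Real.log (mehler g θ x))
    (F' := fun θ x => (Real.log (mehler g θ x) + 1) *
      ∫ y, ⟪G (Real.cos θ • x + Real.sin θ • y), -Real.sin θ • x + Real.cos θ • y⟫ ∂stdGaussian n)
    (bound := fun x => (|Real.log ε| + |Real.log C| + 1) *
      (L * (‖x‖ + ∫ y : E, ‖y‖ ∂stdGaussian n))) Filter.univ_mem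
    (.of_forall fun t => ((hPc t).mul (hlogc t)).aestronglyMeasurable)
    (.of_bound ((hPc θ).mul (hlogc θ)).aestronglyMeasurable
      (C * (|Real.log ε| + |Real.log C|)) (.of_forall fun x => ?_))
    (((hlogc θ).add continuous_const).aestronglyMeasurable.mul ?_)
    (.of_forall fun x t _ => ?_)
    (((integrable_norm_stdGaussian.add (integrable_const _)).const_mul L).const_mul _)
    (.of_forall fun x t _ => ?_)).2
  · rw [norm_mul]
    exact mul_le_mul (hPC θ x) (hlog θ x) (abs_nonneg _) hC0
  · exact (Continuous.stronglyMeasurable (f := fun z : E × E =>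
      ⟪G (Real.cos θ • z.1 + Real.sin θ • z.2), -Real.sin θ • z.1 + Real.cos θ • z.2⟫)
      (by fun_prop)).integral_prod_right'.aestronglyMeasurable
  · rw [norm_mul]
    refine mul_le_mul ((norm_add_le _ _).trans ?_) ?_ (norm_nonneg _) (by positivity)
    · simpa using hlog t x
    · have hi : Integrable (fun y : E => L * (‖x‖ + ‖y‖)) (stdGaussian n) :=
        ((integrable_const _).add integrable_norm_stdGaussian).const_mul L
      refine (norm_integral_le_of_norm_le hi
        (.of_forall fun y => abs_inner_rotation_le hL t x y)).trans_eq ?_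
      rw [integral_const_mul, integral_add (integrable_const _) integrable_norm_stdGaussian]
      simp
  · exact (Real.hasDerivAt_mul_log (hε0.trans_le (hP t x)).ne').comp t
      (hasDerivAt_mehler hg hG hC hL t x)

/-- Jensen's inequality for the Fisher information along the Ornstein–Uhlenbeck semigroup. -/
lemma integral_inner_mehler_le (hg : Continuous g) (hG : Continuous G)
    (hε0 : 0 < ε) (hε : ∀ x, ε ≤ g x) (hC : ∀ x, |g x| ≤ C) (hL : ∀ x, ‖G x‖ ≤ L) (θ : ℝ) :
    ∫ z, ⟪(mehler g θ z.1)⁻¹ • mehler G θ z.1, G (Real.cos θ • z.1 + Real.sin θ • z.2)⟫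
        ∂(stdGaussian n).prod (stdGaussian n) ≤
      ∫ x, ‖G x‖ ^ 2 / g x ∂stdGaussian n := by
  have hP : ∀ x, ε ≤ mehler g θ x := le_mehler hg hC hε θ
  have hP0 : ∀ x, mehler g θ x ≠ 0 := fun x => (hε0.trans_le (hP x)).ne'
  have hPc : Continuous (mehler g θ) := continuous_mehler hg hC θ
  have hQc : Continuous (mehler G θ) := continuous_mehler hG hL θ
  have hL0 : 0 ≤ L := (norm_nonneg _).trans (hL 0)
  set m : E → E := fun x => (mehler g θ x)⁻¹ • mehler G θ x with hm
  have hmc : Continuous m := (hPc.inv₀ hP0).smul hQc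
  have hmL : ∀ x, ‖m x‖ ≤ ε⁻¹ * L := fun x => by
    rw [hm, norm_smul, norm_inv, Real.norm_of_nonneg (hε0.le.trans (hP x))]
    exact mul_le_mul (inv_anti₀ hε0 (hP x)) (norm_mehler_le hL θ x) (norm_nonneg _) (by positivity)
  have hgi : Continuous fun x => ‖G x‖ ^ 2 / g x :=
    (hG.norm.pow 2).div hg fun x => (hε0.trans_le (hε x)).ne'
  have i1 : Integrable (fun z : E × E => ⟪m z.1, G (Real.cos θ • z.1 + Real.sin θ • z.2)⟫)
      ((stdGaussian n).prod (stdGaussian n)) := by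
    refine .of_bound (Continuous.aestronglyMeasurable (by fun_prop)) (ε⁻¹ * L * L)
      (.of_forall fun z => ?_)
    exact (abs_real_inner_le_norm _ _).trans
      (mul_le_mul (hmL _) (hL _) (norm_nonneg _) (by positivity))
  have i2 : Integrable (fun z : E × E => ‖m z.1‖ ^ 2 * g (Real.cos θ • z.1 + Real.sin θ • z.2))
      ((stdGaussian n).prod (stdGaussian n)) := by
    refine .of_bound (Continuous.aestronglyMeasurable (by fun_prop)) ((ε⁻¹ * L) ^ 2 * C)
      (.of_forall fun z => ?_)
    rw [norm_mul, norm_pow, norm_norm]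
    exact mul_le_mul (by gcongr; exact hmL _) (hC _) (abs_nonneg _) (by positivity)
  have i3 : Integrable (fun z : E × E => ‖G (Real.cos θ • z.1 + Real.sin θ • z.2)‖ ^ 2 /
      g (Real.cos θ • z.1 + Real.sin θ • z.2)) ((stdGaussian n).prod (stdGaussian n)) := by
    refine .of_bound (Continuous.aestronglyMeasurable
      (hgi.comp (f := fun z : E × E => Real.cos θ • z.1 + Real.sin θ • z.2) (by fun_prop)))
      (L ^ 2 / ε) (.of_forall fun z => ?_)
    rw [norm_div, norm_pow, norm_norm, Real.norm_of_nonneg (hε0.le.trans (hε _))]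
    gcongr
    · exact hL _
    · exact hε _
  have e1 : ∫ z, ⟪m z.1, G (Real.cos θ • z.1 + Real.sin θ • z.2)⟫
      ∂(stdGaussian n).prod (stdGaussian n) =
      ∫ x, ‖m x‖ ^ 2 * mehler g θ x ∂stdGaussian n := by
    rw [integral_prod _ i1]
    refine integral_congr_ae (.of_forall fun x => ?_)
    have : ∫ y, ⟪m x, G (Real.cos θ • x + Real.sin θ • y)⟫ ∂stdGaussian n =
        ⟪m x, mehler G θ x⟫ := integral_inner (integrable_mehler_integrand hG hL θ x) (m x)
    have hQ : mehler G θ x = mehler g θ x • m x := by rw [hm, smul_inv_smul₀ (hP0 x)]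
    simp only [this]
    rw [hQ, inner_smul_right, real_inner_self_eq_norm_sq, mul_comm]
  have e2 : ∫ z, ‖m z.1‖ ^ 2 * g (Real.cos θ • z.1 + Real.sin θ • z.2)
      ∂(stdGaussian n).prod (stdGaussian n) =
      ∫ x, ‖m x‖ ^ 2 * mehler g θ x ∂stdGaussian n := by
    rw [integral_prod _ i2]
    simp_rw [integral_const_mul]
    rfl
  have e3 : ∫ z, ‖G (Real.cos θ • z.1 + Real.sin θ • z.2)‖ ^ 2 /
      g (Real.cos θ • z.1 + Real.sin θ • z.2) ∂(stdGaussian n).prod (stdGaussian n) =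
      ∫ x, ‖G x‖ ^ 2 / g x ∂stdGaussian n := by
    have := integral_comp_rotation_stdGaussian (n := n) θ
      (h := fun z => ‖G z.1‖ ^ 2 / g z.1) (hgi.comp continuous_fst)
    rw [this, integral_fun_fst (fun x => ‖G x‖ ^ 2 / g x)]
    simp
  have hle := integral_mono (i1.const_mul 2) (i3.add i2) fun z => by
    have h0 : 0 < g (Real.cos θ • z.1 + Real.sin θ • z.2) := hε0.trans_le (hε _)
    simp only [Pi.add_apply]
    generalize g (Real.cos θ • z.1 + Real.sin θ • z.2) = p at h0
    generalize G (Real.cos θ • z.1 + Real.sin θ • z.2) = a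
    have h1 := (real_inner_le_norm (m z.1) a)
    have h2 : ‖a‖ ^ 2 / p + ‖m z.1‖ ^ 2 * p - 2 * (‖m z.1‖ * ‖a‖) =
        (‖a‖ - ‖m z.1‖ * p) ^ 2 / p := by field_simp; ring
    have h3 : 0 ≤ (‖a‖ - ‖m z.1‖ * p) ^ 2 / p := by positivity
    linarith
  rw [integral_const_mul, integral_add' i3 i2, e1, e2, e3] at hle
  rw [e1]
  linarith

/-- The logarithmic Sobolev inequality in terms of the Fisher information. -/
lemma entropy_stdGaussian_le (hg : ∀ x, HasGradientAt g (G x) x) (hG : Continuous G)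
    (hε0 : 0 < ε) (hε : ∀ x, ε ≤ g x) (hC : ∀ x, |g x| ≤ C) (hL : ∀ x, ‖G x‖ ≤ L) :
    ∫ x, g x * Real.log (g x) ∂stdGaussian n -
        (∫ x, g x ∂stdGaussian n) * Real.log (∫ x, g x ∂stdGaussian n) ≤
      1 / 2 * ∫ x, ‖G x‖ ^ 2 / g x ∂stdGaussian n := by
  have hgc : Continuous g := continuous_iff_continuousAt.2 fun v => (hg v).continuousAt
  have hP : ∀ θ x, ε ≤ mehler g θ x := le_mehler hgc hC hε
  have hP0 : ∀ θ x, mehler g θ x ≠ 0 := fun θ x => (hε0.trans_le (hP θ x)).ne'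
  have hL0 : 0 ≤ L := (norm_nonneg _).trans (hL 0)
  set I := ∫ x, ‖G x‖ ^ 2 / g x ∂stdGaussian n
  let J : ℝ → ℝ := fun θ =>
    ∫ z, ⟪(mehler g θ z.1)⁻¹ • mehler G θ z.1, G (Real.cos θ • z.1 + Real.sin θ • z.2)⟫
      ∂(stdGaussian n).prod (stdGaussian n)
  have hJ : ∀ θ, J θ ≤ I := integral_inner_mehler_le hgc hG hε0 hε hC hL
  have hderiv : ∀ θ, HasDerivAt
      (fun θ => ∫ x, mehler g θ x * Real.log (mehler g θ x) ∂stdGaussian n)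
      (-Real.sin θ * (Real.cos θ * J θ)) θ := fun θ => by
    have h := hasDerivAt_integral_mehler_mul_log hg hG hε0 hε hC hL θ
    rw [integral_mul_integral_inner_rotation (w := fun x => Real.log (mehler g θ x) + 1)
      (w' := fun x => Real.cos θ • ((mehler g θ x)⁻¹ • mehler G θ x))
      (M := |Real.log ε| + |Real.log C| + 1) (M' := ε⁻¹ * L) _ _ _ _ hG hL] at h
    · simp_rw [real_inner_smul_left _ _ (Real.cos θ)] at h
      rw [integral_const_mul] at h
      exact h
    · intro v
      rw [hasGradientAt_iff_hasFDerivAt]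
      refine (((hasGradientAt_mehler hg hG hC hL θ v).hasFDerivAt.log
        (hP0 θ v)).add_const 1).congr_fderiv ?_
      rw [← map_smul, smul_comm]
    · exact Continuous.const_smul (((continuous_mehler hgc hC θ).inv₀ (hP0 θ)).smul
        (continuous_mehler hG hL θ)) (Real.cos θ)
    · intro v
      refine (abs_add_le _ _).trans ?_
      simpa using abs_log_le_of_mem_Icc hε0 (hP θ v)
        ((le_abs_self _).trans (norm_mehler_le (h := g) hC θ v))
    · intro v
      rw [norm_smul, norm_smul, norm_inv, Real.norm_of_nonneg (hε0.le.trans (hP θ v))]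
      have := hε0.trans_le (hP θ v)
      exact (mul_le_of_le_one_left (by positivity) (Real.abs_cos_le_one θ)).trans
        (mul_le_mul (inv_anti₀ hε0 (hP θ v)) (norm_mehler_le hL θ v) (norm_nonneg _)
          (by positivity))
  have hderiv' : ∀ θ, HasDerivAt
      (fun θ => ∫ x, mehler g θ x * Real.log (mehler g θ x) ∂stdGaussian n +
        Real.sin θ ^ 2 * (I / 2)) (Real.sin θ * Real.cos θ * (I - J θ)) θ := fun θ => by
    refine ((hderiv θ).add (((Real.hasDerivAt_sin θ).pow 2).mul_const (I / 2))).congr_deriv ?_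
    simp
    ring
  have hmono := monotoneOn_of_deriv_nonneg (convex_Icc 0 (Real.pi / 2))
    (fun θ _ => (hderiv' θ).continuousAt.continuousWithinAt)
    (fun θ _ => (hderiv' θ).differentiableAt.differentiableWithinAt) fun θ hθ => by
      rw [interior_Icc] at hθ
      rw [(hderiv' θ).deriv]
      have h1 := Real.sin_nonneg_of_nonneg_of_le_pi hθ.1.le (by linarith [hθ.2, Real.pi_pos])
      have h2 := Real.cos_nonneg_of_neg_pi_div_two_le_of_le
        (by linarith [hθ.1, Real.pi_pos]) hθ.2.le
      exact mul_nonneg (mul_nonneg h1 h2) (sub_nonneg.2 (hJ θ))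
  have h := hmono (Set.left_mem_Icc.2 (by positivity)) (Set.right_mem_Icc.2 (by positivity))
    (by positivity)
  simp [mehler] at h
  linarith

end

/-- The Gaussian logarithmic Sobolev inequality of L. Gross. -/
theorem gaussian_logSobolev (n : ℕ) (hn : 1 ≤ n)
    (f : EuclideanSpace ℝ (Fin n) → ℝ) (hf : ContDiff ℝ 1 f)
    (Cf : ℝ) (hbd : ∀ x, |f x| ≤ Cf)
    (Cg : ℝ) (hgbd : ∀ x, ‖gradient f x‖ ≤ Cg) :
    ∫ x, (f x) ^ 2 * Real.log ((f x) ^ 2) ∂stdGaussian n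
        - (∫ x, (f x) ^ 2 ∂stdGaussian n)
            * Real.log (∫ x, (f x) ^ 2 ∂stdGaussian n)
      ≤ 2 * ∫ x, ‖gradient f x‖ ^ 2 ∂stdGaussian n := by
  have hfc : Continuous f := hf.continuous
  have hgc : Continuous (gradient f) :=
    (InnerProductSpace.toDual ℝ _).symm.continuous.comp (hf.continuous_fderiv one_ne_zero)
  have hC0 : 0 ≤ Cf := (abs_nonneg _).trans (hbd 0)
  have hsq : ∀ x, f x ^ 2 ≤ Cf ^ 2 := fun x => sq_le_sq' (abs_le.1 (hbd x)).1 (abs_le.1 (hbd x)).2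
  have hi2 : Integrable (fun x => f x ^ 2) (stdGaussian n) :=
    .of_bound (hfc.pow 2).aestronglyMeasurable (Cf ^ 2) (.of_forall fun x => by simpa using hsq x)
  have hig : Integrable (fun x => ‖gradient f x‖ ^ 2) (stdGaussian n) :=
    .of_bound (hgc.norm.pow 2).aestronglyMeasurable (Cg ^ 2) (.of_forall fun x => by
      simpa using pow_le_pow_left₀ (norm_nonneg _) (hgbd x) 2)
  have hgrad : ∀ δ x, HasGradientAt (fun x => f x ^ 2 + δ) ((2 * f x) • gradient f x) x :=
    fun δ x => by
    rw [hasGradientAt_iff_hasFDerivAt]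
    have := ((hf.differentiable one_ne_zero x).hasGradientAt.hasFDerivAt.pow 2).add_const δ
    refine this.congr_fderiv ?_
    ext v
    simp
  have key : ∀ δ : ℝ, 0 < δ →
      ∫ x, (f x ^ 2 + δ) * Real.log (f x ^ 2 + δ) ∂stdGaussian n -
        (∫ x, f x ^ 2 ∂stdGaussian n + δ) * Real.log (∫ x, f x ^ 2 ∂stdGaussian n + δ) ≤
      2 * ∫ x, ‖gradient f x‖ ^ 2 ∂stdGaussian n := fun δ hδ => by
    have h := entropy_stdGaussian_le (C := Cf ^ 2 + δ) (L := 2 * Cf * Cg) (hgrad δ)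
      (by fun_prop) hδ (fun x => le_add_of_nonneg_left (sq_nonneg _))
      (fun x => by
        rw [abs_of_nonneg (by positivity)]
        linarith [hsq x])
      (fun x => by
        rw [norm_smul, norm_mul, Real.norm_ofNat]
        exact mul_le_mul (mul_le_mul_of_nonneg_left (hbd x) zero_le_two) (hgbd x)
          (norm_nonneg _) (by positivity))
    rw [integral_add hi2 (integrable_const δ), integral_const, probReal_univ, one_smul] at h
    refine h.trans ?_
    have : ∫ x, ‖(2 * f x) • gradient f x‖ ^ 2 / (f x ^ 2 + δ) ∂stdGaussian n ≤
        ∫ x, 4 * ‖gradient f x‖ ^ 2 ∂stdGaussian n := by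
      refine integral_mono_of_nonneg (.of_forall fun x => by positivity) (hig.const_mul 4)
        (.of_forall fun x => ?_)
      simp only [norm_smul, mul_pow, norm_mul, Real.norm_ofNat, Real.norm_eq_abs, sq_abs]
      rw [div_le_iff₀ (by positivity)]
      nlinarith [mul_nonneg hδ.le (sq_nonneg ‖gradient f x‖)]
    rw [integral_const_mul] at this
    linarith
  obtain ⟨K, hK⟩ := (isCompact_Icc (a := (0 : ℝ)) (b := Cf ^ 2 + 1)).exists_bound_of_continuousOn
    Real.continuous_mul_log.continuousOn
  have hlim : Filter.Tendsto
      (fun δ : ℝ => ∫ x, (f x ^ 2 + δ) * Real.log (f x ^ 2 + δ) ∂stdGaussian n)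
      (nhdsWithin 0 (Set.Ioi 0))
      (nhds (∫ x, f x ^ 2 * Real.log (f x ^ 2) ∂stdGaussian n)) := by
    refine tendsto_integral_filter_of_dominated_convergence (fun _ => K) (.of_forall fun δ =>
      (Real.continuous_mul_log.comp ((hfc.pow 2).add_const δ)).aestronglyMeasurable) ?_
      (integrable_const K) (.of_forall fun x => ?_)
    · filter_upwards [Ioo_mem_nhdsGT (zero_lt_one' ℝ)] with δ hδ
      exact .of_forall fun x => hK _ ⟨by have := hδ.1; positivity, add_le_add (hsq x) hδ.2.le⟩
    · have : Continuous fun δ : ℝ => (f x ^ 2 + δ) * Real.log (f x ^ 2 + δ) :=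
        Real.continuous_mul_log.comp (continuous_const_add _)
      simpa using (this.tendsto 0).mono_left nhdsWithin_le_nhds
  have hlim' : Filter.Tendsto (fun δ : ℝ => (∫ x, f x ^ 2 ∂stdGaussian n + δ) *
      Real.log (∫ x, f x ^ 2 ∂stdGaussian n + δ)) (nhdsWithin 0 (Set.Ioi 0))
      (nhds ((∫ x, f x ^ 2 ∂stdGaussian n) * Real.log (∫ x, f x ^ 2 ∂stdGaussian n))) := by
    have : Continuous fun δ : ℝ => (∫ x, f x ^ 2 ∂stdGaussian n + δ) *
        Real.log (∫ x, f x ^ 2 ∂stdGaussian n + δ) :=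
      Real.continuous_mul_log.comp (continuous_const_add _)
    simpa using (this.tendsto 0).mono_left nhdsWithin_le_nhds
  exact le_of_tendsto (hlim.sub hlim') (eventually_mem_nhdsWithin.mono key)
end

section
/- Let n ≥ 1 be an integer and let φ : ℝⁿ → ℝ be a continuously differentiable function that is integrable with respect to μ. Then ∫_{ℝⁿ} exp(φ(x) − ∫ φ dμ) dμ(x) ≤ ∫_{ℝⁿ} exp((π²/8)·‖∇φ(x)‖²) dμ(x), where both integrals take values in (0, +∞]. -/
open MeasureTheory

open ProbabilityTheory hiding stdGaussian
open scoped InnerProductSpace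

/-- Jensen's inequality for the exponential, without integrability of the exponential. -/
theorem ofReal_exp_integral_le_lintegral {α : Type*} [MeasurableSpace α] (P : Measure α)
    [IsProbabilityMeasure P] {f : α → ℝ} (hf : Integrable f P) :
    ENNReal.ofReal (Real.exp (∫ x, f x ∂P)) ≤ ∫⁻ x, ENNReal.ofReal (Real.exp (f x)) ∂P := by
  by_cases h : Integrable (fun x => Real.exp (f x)) P
  · rw [← ofReal_integral_eq_lintegral_ofReal h (ae_of_all _ fun x => (Real.exp_pos _).le)]
    exact ENNReal.ofReal_le_ofReal
      (convexOn_exp.map_integral_le Real.continuous_exp.continuousOn isClosed_univ (by simp) hf h)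
  · have hm : AEStronglyMeasurable (fun x => Real.exp (f x)) P :=
      Real.continuous_exp.comp_aestronglyMeasurable hf.1
    have htop : ∫⁻ x, ENNReal.ofReal (Real.exp (f x)) ∂P = ⊤ := by
      by_contra hne
      exact h ((lintegral_ofReal_ne_top_iff_integrable hm
        (ae_of_all _ fun x => (Real.exp_pos _).le)).1 hne)
    rw [htop]
    exact le_top

theorem integrable_stdGaussian_density (n : ℕ) :
    Integrable (fun x : EuclideanSpace ℝ (Fin n) =>
      (2 * Real.pi) ^ (-(n : ℝ) / 2) * Real.exp (-‖x‖ ^ 2 / 2)) := by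
  refine Integrable.const_mul ?_ _
  have h := (GaussianFourier.integrable_cexp_neg_mul_sq_norm_add (b := 1 / 2) (by norm_num) 0
    (0 : EuclideanSpace ℝ (Fin n))).norm
  refine h.congr (ae_of_all _ fun x => ?_)
  have : (-(1 / 2 : ℂ) * (‖x‖ : ℂ) ^ 2 + 0 * ((⟪(0 : EuclideanSpace ℝ (Fin n)), x⟫_ℝ : ℝ) : ℂ))
      = ((-‖x‖ ^ 2 / 2 : ℝ) : ℂ) := by
    push_cast; ring
  simp only [this, Complex.norm_exp, Complex.ofReal_re]

instance isFiniteMeasure_stdGaussian (n : ℕ) : IsFiniteMeasure (stdGaussian n) :=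
  isFiniteMeasure_withDensity_ofReal (integrable_stdGaussian_density n).2

theorem stdGaussian_eq_probabilityTheory_stdGaussian (n : ℕ) :
    stdGaussian n = ProbabilityTheory.stdGaussian (EuclideanSpace ℝ (Fin n)) := by
  apply Measure.ext_of_charFun
  ext t
  rw [charFun_stdGaussian, charFun_apply, stdGaussian,
    integral_withDensity_eq_integral_toReal_smul (by fun_prop) (by simp)]
  have hpi : (0 : ℝ) < 2 * Real.pi := by positivity
  have key : ∀ x : EuclideanSpace ℝ (Fin n),
      (ENNReal.ofReal ((2 * Real.pi) ^ (-(n : ℝ) / 2) * Real.exp (-‖x‖ ^ 2 / 2))).toReal •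
        Complex.exp ((⟪x, t⟫_ℝ : ℝ) * Complex.I) =
      (((2 * Real.pi) ^ (-(n : ℝ) / 2) : ℝ) : ℂ) *
        Complex.exp (-(1 / 2 : ℂ) * (‖x‖ : ℂ) ^ 2 + Complex.I * ((⟪t, x⟫_ℝ : ℝ) : ℂ)) := by
    intro x
    rw [ENNReal.toReal_ofReal (by positivity), Complex.real_smul, Complex.exp_add,
      real_inner_comm]
    push_cast
    rw [mul_assoc]
    congr 3
    · ring
    · ring
  simp_rw [key]
  rw [integral_const_mul, GaussianFourier.integral_cexp_neg_mul_sq_norm_add (by norm_num)]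
  have hc : ((Real.pi : ℂ) / (1 / 2)) ^ (Module.finrank ℝ (EuclideanSpace ℝ (Fin n)) / 2 : ℂ)
      = (((2 * Real.pi) ^ ((n : ℝ) / 2) : ℝ) : ℂ) := by
    rw [Complex.ofReal_cpow hpi.le]
    push_cast
    rw [finrank_euclideanSpace_fin]
    congr 1
    ring
  rw [hc, ← mul_assoc, ← Complex.ofReal_mul, ← Real.rpow_add hpi]
  have : -(n : ℝ) / 2 + n / 2 = 0 := by ring
  rw [this, Real.rpow_zero, Complex.ofReal_one, one_mul, Complex.I_sq]
  congr 1
  ring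

section

variable {E : Type*} [NormedAddCommGroup E] [InnerProductSpace ℝ E] [FiniteDimensional ℝ E]

/-- Increments of a `C¹` function along the quarter circle joining `x` to `y`, exponentiated. -/
theorem ofReal_exp_sub_le_lintegral_rotation {φ : E → ℝ} (hφ : ContDiff ℝ 1 φ) (x y : E) :
    ENNReal.ofReal (Real.exp (φ y - φ x)) ≤
      ∫⁻ θ, ENNReal.ofReal (Real.exp ⟪(Real.pi / 2) • gradient φ
          (ContinuousLinearMap.rotation θ (x, y)).1,
          (ContinuousLinearMap.rotation θ (x, y)).2⟫_ℝ)
        ∂(ENNReal.ofReal (2 / Real.pi) • volume.restrict (Set.Ioc 0 (Real.pi / 2))) := by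
  have hpi := Real.pi_pos
  have hgrad : Continuous (gradient φ) :=
    (InnerProductSpace.toDual ℝ E).symm.continuous.comp (hφ.continuous_fderiv one_ne_zero)
  let ν : Measure ℝ := ENNReal.ofReal (2 / Real.pi) • volume.restrict (Set.Ioc 0 (Real.pi / 2))
  have hν : IsProbabilityMeasure ν := ⟨by
    simp only [ν, Measure.smul_apply, Measure.restrict_apply_univ, Real.volume_Ioc, sub_zero,
      smul_eq_mul]
    rw [← ENNReal.ofReal_mul (by positivity)]
    simp [field]⟩
  set f : ℝ → ℝ := fun θ => ⟪(Real.pi / 2) • gradient φ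
          (ContinuousLinearMap.rotation θ (x, y)).1,
          (ContinuousLinearMap.rotation θ (x, y)).2⟫_ℝ with hf
  have hfc : Continuous f := by
    simp only [hf, ContinuousLinearMap.rotation_apply]
    fun_prop
  have hderiv : ∀ θ : ℝ, HasDerivAt
      (fun θ => Real.pi / 2 * φ (Real.cos θ • x + Real.sin θ • y)) (f θ) θ := by
    intro θ
    have h1 : HasDerivAt (fun θ : ℝ => Real.cos θ • x + Real.sin θ • y)
        (-Real.sin θ • x + Real.cos θ • y) θ :=
      ((Real.hasDerivAt_cos θ).smul_const x).add ((Real.hasDerivAt_sin θ).smul_const y)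
    have h2 := ((hφ.differentiable one_ne_zero
      (Real.cos θ • x + Real.sin θ • y)).hasGradientAt.hasFDerivAt.comp_hasDerivAt θ h1).const_mul
        (Real.pi / 2)
    simpa [hf, ContinuousLinearMap.rotation_apply, inner_smul_left] using h2
  have hint : ∫ θ, f θ ∂ν = φ y - φ x := by
    simp only [ν]
    rw [integral_smul_measure, ← intervalIntegral.integral_of_le (by positivity),
      intervalIntegral.integral_eq_sub_of_hasDerivAt (fun θ _ => hderiv θ)
        (hfc.intervalIntegrable _ _), ENNReal.toReal_ofReal (by positivity)]
    simp only [Real.cos_pi_div_two, Real.sin_pi_div_two, Real.cos_zero, Real.sin_zero, zero_smul,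
      one_smul, zero_add, add_zero, smul_eq_mul]
    field_simp
  rw [← hint]
  refine ofReal_exp_integral_le_lintegral ν (Integrable.smul_measure ?_ ENNReal.ofReal_ne_top)
  exact (hfc.integrableOn_Icc).mono_set Set.Ioc_subset_Icc_self

variable [MeasurableSpace E] [BorelSpace E]

/-- Laplace transform of the standard Gaussian measure. -/
theorem lintegral_exp_inner_stdGaussian (w : E) :
    ∫⁻ v, ENNReal.ofReal (Real.exp ⟪w, v⟫_ℝ) ∂(ProbabilityTheory.stdGaussian E)
      = ENNReal.ofReal (Real.exp (‖w‖ ^ 2 / 2)) := by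
  have hmap := IsGaussian.map_eq_gaussianReal (μ := ProbabilityTheory.stdGaussian E)
    (innerSL ℝ w)
  rw [variance_dual_stdGaussian, integral_strongDual_stdGaussian, innerSL_apply_norm] at hmap
  have hmgf := mgf_gaussianReal hmap 1
  have hint : Integrable (fun v => Real.exp ⟪w, v⟫_ℝ) (ProbabilityTheory.stdGaussian E) := by
    by_contra h
    have : mgf (innerSL ℝ w) (ProbabilityTheory.stdGaussian E) 1 = 0 := by
      rw [mgf, integral_undef]
      simpa using h
    rw [this] at hmgf
    exact (Real.exp_pos _).ne hmgf
  rw [← ofReal_integral_eq_lintegral_ofReal hint (ae_of_all _ fun x => (Real.exp_pos _).le)]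
  congr 1
  simpa [mgf] using hmgf

/-- Pisier's inequality for the exponential of increments under the standard Gaussian measure. -/
theorem lintegral_exp_sub_stdGaussian_le {φ : E → ℝ} (hφ : ContDiff ℝ 1 φ) :
    ∫⁻ p : E × E, ENNReal.ofReal (Real.exp (φ p.2 - φ p.1))
        ∂((ProbabilityTheory.stdGaussian E).prod (ProbabilityTheory.stdGaussian E)) ≤
      ∫⁻ x, ENNReal.ofReal (Real.exp (Real.pi ^ 2 / 8 * ‖gradient φ x‖ ^ 2))
        ∂(ProbabilityTheory.stdGaussian E) := by
  have hpi := Real.pi_pos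
  have hgrad : Continuous (gradient φ) :=
    (InnerProductSpace.toDual ℝ E).symm.continuous.comp (hφ.continuous_fderiv one_ne_zero)
  set G := ProbabilityTheory.stdGaussian E with hG
  let F : E × E → ENNReal := fun p =>
    ENNReal.ofReal (Real.exp ⟪(Real.pi / 2) • gradient φ p.1, p.2⟫_ℝ)
  have hF : Measurable F := by
    refine (ENNReal.continuous_ofReal.comp ?_).measurable
    fun_prop
  have hFrot : Measurable fun q : (E × E) × ℝ => F (ContinuousLinearMap.rotation q.2 q.1) := by
    refine hF.comp (Continuous.measurable ?_)
    simp only [ContinuousLinearMap.rotation_apply]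
    fun_prop
  calc
    _ ≤ ∫⁻ p : E × E, ∫⁻ θ, F (ContinuousLinearMap.rotation θ p)
          ∂(ENNReal.ofReal (2 / Real.pi) • volume.restrict (Set.Ioc 0 (Real.pi / 2)))
          ∂(G.prod G) :=
      lintegral_mono fun p => ofReal_exp_sub_le_lintegral_rotation hφ p.1 p.2
    _ = ∫⁻ θ, ∫⁻ p, F (ContinuousLinearMap.rotation θ p) ∂(G.prod G)
          ∂(ENNReal.ofReal (2 / Real.pi) • volume.restrict (Set.Ioc 0 (Real.pi / 2))) :=
      lintegral_lintegral_swap hFrot.aemeasurable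
    _ = ∫⁻ _ : ℝ, ∫⁻ p, F p ∂(G.prod G)
          ∂(ENNReal.ofReal (2 / Real.pi) • volume.restrict (Set.Ioc 0 (Real.pi / 2))) := by
      refine lintegral_congr fun θ => ?_
      rw [← lintegral_map hF (by fun_prop),
        IsGaussian.map_rotation_eq_self (by simp [hG]) θ]
    _ = ∫⁻ p, F p ∂(G.prod G) := by
      rw [lintegral_const, Measure.smul_apply, Measure.restrict_apply_univ, Real.volume_Ioc,
        sub_zero, smul_eq_mul, ← ENNReal.ofReal_mul (by positivity)]
      simp [field]
    _ = _ := by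
      rw [lintegral_prod _ hF.aemeasurable]
      refine lintegral_congr fun x => ?_
      simp only [F, hG, lintegral_exp_inner_stdGaussian, norm_smul, Real.norm_eq_abs,
        mul_pow, sq_abs]
      congr 2
      ring

end

/-- Exponential Poincaré inequality:
`E[exp(φ - E[φ])] ≤ E[exp((π²/8)‖∇φ‖²)]`, integrals valued in `(0, +∞]`. -/
theorem gaussian_exp_poincare (n : ℕ) (hn : 1 ≤ n)
    (φ : EuclideanSpace ℝ (Fin n) → ℝ) (hφ : ContDiff ℝ 1 φ)
    (hint : Integrable φ (stdGaussian n)) :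
    ∫⁻ x, ENNReal.ofReal (Real.exp (φ x - ∫ y, φ y ∂stdGaussian n)) ∂stdGaussian n
      ≤ ∫⁻ x, ENNReal.ofReal (Real.exp (Real.pi ^ 2 / 8 * ‖gradient φ x‖ ^ 2))
          ∂stdGaussian n := by
  rw [stdGaussian_eq_probabilityTheory_stdGaussian] at hint ⊢
  refine le_trans ?_ (lintegral_exp_sub_stdGaussian_le hφ)
  have hc := hφ.continuous
  have hmeas : Measurable fun p : EuclideanSpace ℝ (Fin n) × EuclideanSpace ℝ (Fin n) =>
      ENNReal.ofReal (Real.exp (φ p.2 - φ p.1)) := by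
    refine (ENNReal.continuous_ofReal.comp ?_).measurable
    fun_prop
  rw [lintegral_prod_symm' _ hmeas]
  refine lintegral_mono fun x => ?_
  have h := ofReal_exp_integral_le_lintegral
    (ProbabilityTheory.stdGaussian (EuclideanSpace ℝ (Fin n)))
    ((integrable_const (φ x)).sub hint)
  simpa [integral_sub (integrable_const (φ x)) hint] using h
end
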